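/- Let σ be the Frobenius generator of Gal(K/ℚ_p), let v ∈ μ_{q−1}, u = v^{1−p}, and let σ̃ be any field embedding of ℚ̄_p into itself (or of the Galois closure of L_u over ℚ_p into ℚ̄_p) whose restriction to K equals σ. Then σ̃(L_u) is the splitting field over K of (X^p + σ(u)·p·X)^{p−1} + p, and σ̃(M_u) = M_{σ(u)}. Moreover M_u/ℚ_p is Galois if and only if σ(u) = u, i.e. if and only if u^p = u. -/

import Mathlib

open Polynomial Filter IntermediateField

variable (p : ℕ) [Fact p.Prime]

/-- A fixed algebraic closure of `ℚ_p`. -/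
noncomputable abbrev Qpbar := AlgebraicClosure ℚ_[p]

/-- The unramified extension `K` of `ℚ_p` of degree `d` inside `ℚ̄_p`, realized as the
splitting field of `X^(p^d - 1) - 1`. -/
noncomputable def Kur (d : ℕ) : IntermediateField ℚ_[p] (Qpbar p) :=
  IntermediateField.adjoin ℚ_[p] {x : Qpbar p | x ^ (p ^ d - 1) = 1}

/-- The splitting field `L_w` over `K`, inside `ℚ̄_p`, of `(X^p + w p X)^{p-1} + p`,
as an extension of `ℚ_p`. -/
noncomputable def Lsplit (d : ℕ) (w : Qpbar p) : IntermediateField ℚ_[p] (Qpbar p) :=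
  Kur p d ⊔ IntermediateField.adjoin ℚ_[p]
    {x : Qpbar p | (((X ^ p + C (w * (p : Qpbar p)) * X) ^ (p - 1) + C (p : Qpbar p)) :
      Polynomial (Qpbar p)).IsRoot x}

/-- `ψ_w(X) = X (X + w p)^{p-1} + p` as a polynomial over `ℚ̄_p`. -/
noncomputable def psiPoly (w : Qpbar p) : Polynomial (Qpbar p) :=
  X * (X + C (w * (p : Qpbar p))) ^ (p - 1) + C (p : Qpbar p)

/-- The splitting field `M_w` of `ψ_w` over `K` inside `ℚ̄_p`, as an extension of `ℚ_p`. -/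
noncomputable def Msplit (d : ℕ) (w : Qpbar p) : IntermediateField ℚ_[p] (Qpbar p) :=
  Kur p d ⊔ IntermediateField.adjoin ℚ_[p] {x : Qpbar p | (psiPoly p w).IsRoot x}


section AbstractPart

variable {F : Type*} [Field F]

/-- The valuation ring of a nonarchimedean absolute value. -/
def avRing (abv : AbsoluteValue F ℝ) (hna : IsNonarchimedean abv) : ValuationSubring F where
  carrier := {x | abv x ≤ 1}
  mul_mem' := by
    intro a b ha hb
    simp only [Set.mem_ofPred_eq, map_mul] at *
    exact mul_le_one₀ ha (abv.nonneg b) hb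
  one_mem' := by simp
  add_mem' := by
    intro a b ha hb
    exact (hna a b).trans (max_le ha hb)
  zero_mem' := by simp
  neg_mem' := by
    intro a ha
    simpa using ha
  mem_or_inv_mem' := by
    intro x
    simp only [Set.mem_ofPred_eq, map_inv₀]
    rcases le_total (abv x) 1 with h | h
    · exact Or.inl h
    · exact Or.inr (inv_le_one_of_one_le₀ h)

variable (abv : AbsoluteValue F ℝ)

theorem mem_avRing (hna : IsNonarchimedean abv) (x : F) : x ∈ avRing abv hna ↔ abv x ≤ 1 := Iff.rfl

theorem avRing_residue_eq_zero (hna : IsNonarchimedean abv) (x : avRing abv hna) :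
    IsLocalRing.residue _ x = 0 ↔ abv (x : F) < 1 := by
  rw [IsLocalRing.residue_eq_zero_iff, IsLocalRing.mem_maximalIdeal, mem_nonunits_iff]
  have hx : abv (x : F) ≤ 1 := x.2
  rw [← not_iff_not, not_not, not_lt]
  constructor
  · rintro ⟨y, rfl⟩
    have h1 : abv ((y : avRing abv hna) : F) * abv ((y⁻¹ : (avRing abv hna)ˣ) : avRing abv hna) = 1 := by
      rw [← map_mul, ← map_one abv]
      congr 1
      exact congrArg Subtype.val (Units.mul_inv y)
    have h2 : abv (((y⁻¹ : (avRing abv hna)ˣ) : avRing abv hna) : F) ≤ 1 :=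
      ((y⁻¹ : (avRing abv hna)ˣ) : avRing abv hna).2
    nlinarith [abv.nonneg ((y : avRing abv hna) : F)]
  · intro h
    have h1 : abv (x : F) = 1 := le_antisymm hx h
    have h0 : (x : F) ≠ 0 := by
      intro h0
      rw [h0] at h1
      simp at h1
    refine IsUnit.of_mul_eq_one ⟨(x : F)⁻¹, ?_⟩ ?_
    · rw [mem_avRing]; simp [h1]
    · ext
      simp [h0]

theorem avRing_residue_eq (hna : IsNonarchimedean abv) (x y : avRing abv hna) :
    IsLocalRing.residue _ x = IsLocalRing.residue _ y ↔ abv ((x : F) - y) < 1 := by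
  rw [← sub_eq_zero, ← map_sub, avRing_residue_eq_zero]
  rfl

theorem avRing_charP (hna : IsNonarchimedean abv) (hp1 : abv (p : F) < 1) :
    CharP (IsLocalRing.ResidueField (avRing abv hna)) p := by
  apply (CharP.charP_iff_prime_eq_zero (Fact.out : p.Prime)).2
  have : ((p : ℕ) : IsLocalRing.ResidueField (avRing abv hna)) =
    IsLocalRing.residue _ (p : avRing abv hna) := by simp
  rw [this, avRing_residue_eq_zero]
  simpa using hp1

/-- An element with `z^p ≡ z` is congruent to an integer. -/
theorem exists_int_close (hna : IsNonarchimedean abv) (hp1 : abv (p : F) < 1) (z : F) (hz : abv z ≤ 1)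
    (h : abv (z ^ p - z) < 1) : ∃ n : ℕ, abv (z - n) < 1 := by
  have := avRing_charP p abv hna hp1
  set z' : avRing abv hna := ⟨z, hz⟩
  have h1 : (IsLocalRing.residue _ z') ^ p = IsLocalRing.residue _ z' := by
    rw [← map_pow, avRing_residue_eq]
    simpa using h
  rw [← Subfield.mem_bot_iff_pow_eq_self, ← ZMod.fieldRange_castHom_eq_bot p] at h1
  obtain ⟨c, hc⟩ := h1
  refine ⟨c.val, ?_⟩
  have h2 : IsLocalRing.residue _ z' = IsLocalRing.residue _ ((c.val : ℕ) : avRing abv hna) := by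
    rw [← hc, map_natCast]
    simp
  rw [avRing_residue_eq] at h2
  exact h2

/-- Distinct roots of unity of order prime to `p` are not congruent. -/
theorem root_of_unity_eq (hna : IsNonarchimedean abv) (N : ℕ) (hN : abv (N : F) = 1) (x y : F)
    (hx : x ^ N = 1) (hy : y ^ N = 1) (h : abv (x - y) < 1) : x = y := by
  have hN0 : N ≠ 0 := by
    rintro rfl
    simp at hN
  have ax : abv x = 1 := by
    have : abv x ^ N = 1 := by rw [← map_pow, hx, map_one]
    exact (pow_eq_one_iff_of_nonneg (abv.nonneg _) hN0).1 this
  have ay : abv y = 1 := by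
    have : abv y ^ N = 1 := by rw [← map_pow, hy, map_one]
    exact (pow_eq_one_iff_of_nonneg (abv.nonneg _) hN0).1 this
  by_contra hne
  set x' : avRing abv hna := ⟨x, ax.le⟩
  set y' : avRing abv hna := ⟨y, ay.le⟩
  have hr : IsLocalRing.residue _ x' = IsLocalRing.residue _ y' := by
    rw [avRing_residue_eq]; exact h
  have hs : (∑ i ∈ Finset.range N, x ^ i * y ^ (N - 1 - i)) = 0 := by
    have := (Commute.all x y).geom_sum₂_mul N
    rw [hx, hy, sub_self] at this
    exact (mul_eq_zero.1 this).resolve_right (sub_ne_zero.2 hne)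
  have hs' : (∑ i ∈ Finset.range N, x' ^ i * y' ^ (N - 1 - i)) = 0 := by
    ext
    simpa using hs
  have h2 := congrArg (IsLocalRing.residue _) hs'
  rw [map_sum] at h2
  simp only [map_mul, map_pow, hr, map_zero] at h2
  rw [Finset.sum_congr rfl (g := fun _ => IsLocalRing.residue _ (y' ^ (N - 1)))] at h2
  · rw [Finset.sum_const, Finset.card_range, ← map_nsmul, avRing_residue_eq_zero] at h2
    simp only [nsmul_eq_mul] at h2
    have : abv ((N : F) * y ^ (N - 1)) < 1 := h2
    rw [map_mul, map_pow, hN, ay] at this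
    simp at this
  · intro i hi
    rw [← pow_add, map_pow]
    congr 1
    have := Finset.mem_range.1 hi
    omega

/-- Absolute value of a shifted root of `ψ_w`. -/
theorem psi_root_abs (hna : IsNonarchimedean abv) (hp1 : abv (p : F) < 1) (hp0 : (p : F) ≠ 0)
    (w a : F) (hw : abv w ≤ 1)
    (ha : (a - w * p) * a ^ (p - 1) = -p) :
    abv (w * p) < abv a ∧ abv a ^ p = abv (p : F) ∧ abv (a - w * p) = abv a := by
  have hp2 : 2 ≤ p := (Fact.out : p.Prime).two_le
  have hppos : 0 < abv (p : F) := abv.pos hp0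
  have hwp : abv (w * p) ≤ abv (p : F) := by
    rw [map_mul]
    exact mul_le_of_le_one_left hppos.le hw
  have ha' : abv (a - w * p) * abv a ^ (p - 1) = abv (p : F) := by
    rw [← map_pow, ← map_mul, ha, abv.map_neg]
  have hlt : abv (p : F) < abv a := by
    by_contra hcon
    push Not at hcon
    have h1 : abv (a - w * p) ≤ abv (p : F) := by
      rw [sub_eq_add_neg]
      refine (hna _ _).trans (max_le hcon ?_)
      rw [abv.map_neg]; exact hwp
    have h2 : abv a ^ (p - 1) < 1 :=
      pow_lt_one₀ (abv.nonneg _) (hcon.trans_lt hp1) (by omega)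
    have h3 : 0 ≤ abv a ^ (p - 1) := pow_nonneg (abv.nonneg _) _
    nlinarith [abv.nonneg (a - w * p)]
  have h1 : abv (a - w * p) = abv a := by
    rw [sub_eq_add_neg]
    apply hna.add_eq_left_of_lt
    rw [abv.map_neg]
    exact hwp.trans_lt hlt
  refine ⟨hwp.trans_lt hlt, ?_, h1⟩
  rw [h1] at ha'
  rw [← ha', ← pow_succ']
  congr 1
  omega

/-- Difference of two shifted roots of `ψ_w`. -/
theorem psi_root_diff (hna : IsNonarchimedean abv) (hp1 : abv (p : F) < 1) (hp0 : (p : F) ≠ 0)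
    (w a b : F) (hw : abv w ≤ 1)
    (ha : (a - w * p) * a ^ (p - 1) = -p) (hb : (b - w * p) * b ^ (p - 1) = -p) (hne : b ≠ a) :
    ∃ y : F, b - a = a ^ 2 * y ∧ abv y ≤ 1 ∧ abv (y ^ (p - 1) - w) < 1 := by
  have hp2 : 2 ≤ p := (Fact.out : p.Prime).two_le
  have hpp : p - 1 + 1 = p := by omega
  obtain ⟨ha1, ha2, ha3⟩ := psi_root_abs p abv hna hp1 hp0 w a hw ha
  obtain ⟨hb1, hb2, hb3⟩ := psi_root_abs p abv hna hp1 hp0 w b hw hb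
  have hppos : 0 < abv (p : F) := abv.pos hp0
  have hapos : 0 < abv a := (abv.nonneg _).trans_lt ha1
  have ha0 : a ≠ 0 := by
    rintro rfl
    simp at hapos
  have hab : abv a = abv b :=
    (pow_left_inj₀ (abv.nonneg _) (abv.nonneg _) (by omega : p ≠ 0)).1 (ha2.trans hb2.symm)
  have haI : abv a < 1 := by
    by_contra hcon
    push Not at hcon
    have := one_le_pow₀ hcon (n := p)
    linarith
  have := avRing_charP p abv hna hp1
  -- the unit `e`
  have he1 : abv ((p : F) / a ^ p) = 1 := by
    rw [map_div₀, map_pow, ha2, div_self hppos.ne']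
  set e : avRing abv hna := ⟨(p : F) / a ^ p, he1.le⟩ with he
  have hpe : (p : F) = a ^ p * e := by
    simp only [he]
    field_simp
  have hre : IsLocalRing.residue _ e = -1 := by
    rw [← sub_eq_zero, sub_neg_eq_add, ← map_one (IsLocalRing.residue (avRing abv hna)), ← map_add,
      avRing_residue_eq_zero]
    have : ((e + 1 : avRing abv hna) : F) = w * p / a := by
      have h1 : ((e + 1 : avRing abv hna) : F) = (p : F) / a ^ p + 1 := rfl
      rw [h1]
      have h2 : (p : F) = - ((a - w * p) * a ^ (p - 1)) := by rw [ha]; ring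
      have h3 : a ^ p = a ^ (p - 1) * a := by rw [← pow_succ, hpp]
      rw [h3]
      field_simp
      linear_combination h2
    rw [this, map_div₀]
    exact (div_lt_one hapos).2 ha1
  have hη1 : abv ((b - a) / a) ≤ 1 := by
    rw [map_div₀]
    apply (div_le_one hapos).2
    rw [sub_eq_add_neg]
    refine (hna _ _).trans (max_le hab.ge ?_)
    rw [abv.map_neg]
  set η : avRing abv hna := ⟨(b - a) / a, hη1⟩ with hη
  have hηb : a * η = b - a := by
    simp only [hη]
    field_simp
  have hη0 : (η : F) ≠ 0 := div_ne_zero (sub_ne_zero.2 hne) ha0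
  obtain ⟨g, hg⟩ := (Commute.all (1 : avRing abv hna) η).exists_add_pow_prime_eq
    (Fact.out : p.Prime)
  set h : avRing abv hna := ∑ i ∈ Finset.range (p - 1), (1 + η) ^ i with hh
  have hgeom : h * η = (1 + η) ^ (p - 1) - 1 := by
    have := geom_sum_mul (1 + η) (p - 1)
    rw [← this]
    congr 1
    ring
  have hgF : (1 + (η : F)) ^ p = 1 + (η : F) ^ p + p * η * g := by
    have := congrArg (Subtype.val) hg
    simpa using this
  have hgeomF : (h : F) * η = (1 + (η : F)) ^ (p - 1) - 1 := by
    have := congrArg (Subtype.val) hgeom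
    simpa using this
  have hbη : b = a * (1 + η) := by linear_combination -hηb
  have key : (η : F) ^ (p - 1) + p * g = w * a ^ (p - 1) * e * h := by
    have h1 : (b - w * p) * b ^ (p - 1) = (a - w * p) * a ^ (p - 1) := by rw [ha, hb]
    rw [hbη, mul_pow] at h1
    have h2 : a * (1 + (η : F)) ^ p - w * p * (1 + (η : F)) ^ (p - 1) = a - w * p := by
      have h3 : a ^ (p - 1) ≠ 0 := pow_ne_zero _ ha0
      apply mul_left_cancel₀ h3
      have h4 : (1 + (η : F)) ^ p = (1 + (η : F)) ^ (p - 1) * (1 + (η : F)) := by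
        rw [← pow_succ, hpp]
      rw [h4]
      linear_combination h1
    have h5 : (η : F) ^ p = (η : F) ^ (p - 1) * η := by rw [← pow_succ, hpp]
    have h6 : (1 + (η : F)) ^ (p - 1) = h * η + 1 := by rw [hgeomF]; ring
    rw [hgF, h6, h5] at h2
    apply mul_left_cancel₀ (mul_ne_zero ha0 hη0)
    have h7 : (p : F) = a ^ (p - 1) * a * e := by rw [← pow_succ, hpp]; exact hpe
    linear_combination h2 + w * h * η * h7
  have key2 : ((η : F) / a) ^ (p - 1) = e * (w * h - a * g) := by
    have h3 : a ^ (p - 1) ≠ 0 := pow_ne_zero _ ha0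
    have h7 : (p : F) = a ^ (p - 1) * a * e := by rw [← pow_succ, hpp]; exact hpe
    rw [div_pow, div_eq_iff h3]
    linear_combination key - g * h7
  set w' : avRing abv hna := ⟨w, hw⟩ with hw'
  set a' : avRing abv hna := ⟨a, haI.le⟩ with ha'
  have hy1 : abv ((η : F) / a) ≤ 1 := by
    have h1 : abv ((η : F) / a) ^ (p - 1) ≤ 1 := by
      rw [← map_pow, key2]
      exact (e * (w' * h - a' * g)).2
    exact (pow_le_one_iff_of_nonneg (abv.nonneg _) (by omega)).1 h1
  refine ⟨(η : F) / a, ?_, hy1, ?_⟩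
  · rw [← hηb]
    field_simp
  set y' : avRing abv hna := ⟨(η : F) / a, hy1⟩ with hy'
  have hηy : η = a' * y' := by
    ext
    change (η : F) = a * (η / a)
    field_simp
  have hra : IsLocalRing.residue _ a' = 0 := (avRing_residue_eq_zero _ _ _).2 haI
  have hrη : IsLocalRing.residue _ η = 0 := by rw [hηy, map_mul, hra, zero_mul]
  have hrh : IsLocalRing.residue _ h = -1 := by
    rw [hh, map_sum]
    simp only [map_pow, map_add, map_one, hrη, add_zero, one_pow, Finset.sum_const,
      Finset.card_range, nsmul_eq_mul, mul_one]
    rw [Nat.cast_sub (by omega), CharP.cast_eq_zero]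
    simp
  have hfin : IsLocalRing.residue _ (y' ^ (p - 1)) = IsLocalRing.residue _ w' := by
    have : y' ^ (p - 1) = e * (w' * h - a' * g) := by
      ext
      exact key2
    rw [this, map_mul, map_sub, map_mul, map_mul, hra, hrh, hre]
    ring
  rw [avRing_residue_eq] at hfin
  exact hfin

/-- Distinct shifted roots of `ψ_w` have distance exactly `|a|^2`. -/
theorem psi_root_dist (hna : IsNonarchimedean abv) (hp1 : abv (p : F) < 1) (hp0 : (p : F) ≠ 0)
    (w a b : F) (hw : abv w = 1)
    (ha : (a - w * p) * a ^ (p - 1) = -p) (hb : (b - w * p) * b ^ (p - 1) = -p) (hne : b ≠ a) :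
    abv (b - a) = abv a ^ 2 := by
  have hp2 : 2 ≤ p := (Fact.out : p.Prime).two_le
  obtain ⟨y, h1, h2, h3⟩ := psi_root_diff p abv hna hp1 hp0 w a b hw.le ha hb hne
  have h4 : abv (y ^ (p - 1)) = 1 := by
    rw [← hw, ← sub_add_cancel (y ^ (p - 1)) w]
    apply hna.add_eq_right_of_lt
    rw [hw]; exact h3
  rw [map_pow] at h4
  have h5 : abv y = 1 := (pow_eq_one_iff_of_nonneg (abv.nonneg _) (by omega)).1 h4
  rw [h1, map_mul, h5, mul_one, map_pow]

/-- Krasner-type argument. -/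
theorem psi_root_fixed (hna : IsNonarchimedean abv) (hp1 : abv (p : F) < 1) (hp0 : (p : F) ≠ 0)
    (w v a b : F) (hv : abv v = 1) (hwv : v ^ (p - 1) * w = 1)
    (ha : (a - w * p) * a ^ (p - 1) = -p) (hb : (b - w * p) * b ^ (p - 1) = -p)
    (τ : F →+* F) (hτ : ∀ x, abv (τ x) = abv x) (hτv : τ v = v) (hτa : τ a = a) : τ b = b := by
  have hp2 : 2 ≤ p := (Fact.out : p.Prime).two_le
  have hpp : p - 1 + 1 = p := by omega
  have hw : abv w = 1 := by
    have := congrArg abv hwv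
    simpa [hv] using this
  have hv0 : v ≠ 0 := by
    rintro rfl
    simp at hv
  have hτw : τ w = w := by
    have h1 := congrArg τ hwv
    rw [map_mul, map_pow, hτv, map_one, ← hwv] at h1
    exact mul_left_cancel₀ (pow_ne_zero _ hv0) h1
  by_cases hne : b = a
  · rw [hne, hτa]
  obtain ⟨y, h1, h2, h3⟩ := psi_root_diff p abv hna hp1 hp0 w a b hw.le ha hb hne
  have hvy : abv (v * y) ≤ 1 := by rw [map_mul, hv, one_mul]; exact h2
  obtain ⟨n, hn⟩ := exists_int_close p abv hna hp1 (v * y) hvy (by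
    have : (v * y) ^ p - v * y = v * y * (v ^ (p - 1) * (y ^ (p - 1) - w)) := by
      have : (v * y) ^ p = v ^ (p - 1) * y ^ (p - 1) * (v * y) := by
        rw [← mul_pow, ← pow_succ, hpp]
      rw [this]
      linear_combination v * y * hwv
    rw [this, map_mul, map_mul _ (v ^ (p - 1)), map_pow, hv, one_pow, one_mul]
    exact mul_lt_one_of_nonneg_of_lt_one_right hvy (abv.nonneg _) h3)
  have hn' : abv (v * τ y - n) < 1 := by
    have := hτ (v * y - n)
    rw [map_sub, map_mul, hτv, map_natCast] at this
    rw [this]; exact hn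
  have hyy : abv (τ y - y) < 1 := by
    have h5 : v * (τ y - y) = (v * τ y - n) + (-(v * y - n)) := by ring
    have h6 : abv (v * (τ y - y)) < 1 := by
      rw [h5]
      refine (hna _ _).trans_lt (max_lt hn' ?_)
      rw [abv.map_neg]; exact hn
    rwa [map_mul, hv, one_mul] at h6
  by_contra hτb
  have hb' : (τ b - w * p) * (τ b) ^ (p - 1) = -p := by
    have := congrArg τ hb
    simpa [hτw] using this
  have hd := psi_root_dist p abv hna hp1 hp0 w b (τ b) hw hb hb' hτb
  have h7 : τ b - b = a ^ 2 * (τ y - y) := by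
    have h8 := congrArg τ h1
    rw [map_sub, map_mul, map_pow, hτa] at h8
    linear_combination h8 - h1
  obtain ⟨ha1, ha2, ha3⟩ := psi_root_abs p abv hna hp1 hp0 w a hw.le ha
  obtain ⟨hb1, hb2, hb3⟩ := psi_root_abs p abv hna hp1 hp0 w b hw.le hb
  have hab : abv a = abv b :=
    (pow_left_inj₀ (abv.nonneg _) (abv.nonneg _) (by omega : p ≠ 0)).1 (ha2.trans hb2.symm)
  have hapos : 0 < abv a := (abv.nonneg _).trans_lt ha1
  rw [h7, map_mul, map_pow, hab] at hd
  rw [hab] at hapos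
  have : 0 < abv b ^ 2 := by positivity
  nlinarith

end AbstractPart

/-- An extension generated by a root of unity of order prime to `p` is unramified
(in the sense of value groups). -/
theorem unramified_value {k E : Type*} [Field k] [Field E] [Algebra k E] [FiniteDimensional k E]
    [IsGalois k E] (abv : AbsoluteValue E ℝ) (hna : IsNonarchimedean abv)
    (hinv : ∀ (g : E ≃ₐ[k] E) (x : E), abv (g x) = abv x)
    (N : ℕ) (hN : abv (N : E) = 1) (ζ : E) (hζ : ζ ^ N = 1)
    (hgen : ∀ g : E ≃ₐ[k] E, g ζ = ζ → g = 1) (x : E) :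
    ∃ t : k, abv x = abv (algebraMap k E t) := by
  classical
  have hN0 : N ≠ 0 := by
    rintro rfl
    simp at hN
  have aζ : abv ζ = 1 := by
    have : abv ζ ^ N = 1 := by rw [← map_pow, hζ, map_one]
    exact (pow_eq_one_iff_of_nonneg (abv.nonneg _) hN0).1 this
  set Q : E[X] := ∏ g ∈ (Finset.univ : Finset (E ≃ₐ[k] E)).erase 1, (X - C (g ζ)) with hQ
  have hQc : ∀ i, abv (Q.coeff i) ≤ 1 := by
    have h1 : Q ∈ Polynomial.lifts (avRing abv hna).subtype := by
      rw [hQ]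
      apply Subsemiring.prod_mem
      intro g _
      have hm : g ζ ∈ avRing abv hna := by rw [mem_avRing, hinv, aζ]
      exact ⟨X - C ⟨g ζ, hm⟩, by simp [ValuationSubring.subtype_apply]⟩
    intro i
    rw [Polynomial.lifts_iff_coeff_lifts] at h1
    obtain ⟨c, hc⟩ := h1 i
    rw [← hc]
    exact c.2
  have hQζ : abv (Q.eval ζ) = 1 := by
    rw [hQ, Polynomial.eval_prod, map_prod]
    apply Finset.prod_eq_one
    intro g hg
    have hg1 : g ≠ 1 := (Finset.mem_erase.1 hg).1
    simp only [eval_sub, eval_X, eval_C]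
    apply le_antisymm
    · rw [sub_eq_add_neg]
      refine (hna _ _).trans (max_le aζ.le ?_)
      rw [abv.map_neg, hinv, aζ]
    · by_contra hcon
      push Not at hcon
      have := root_of_unity_eq abv hna N hN ζ (g ζ) hζ (by rw [← map_pow, hζ, map_one]) hcon
      exact hg1 (hgen g this.symm)
  have hQg : ∀ g : E ≃ₐ[k] E, g ≠ 1 → Q.eval (g ζ) = 0 := by
    intro g hg
    rw [hQ, Polynomial.eval_prod]
    apply Finset.prod_eq_zero (Finset.mem_erase.2 ⟨hg, Finset.mem_univ g⟩)
    simp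
  set T : ℕ → E := fun i => ∑ g : E ≃ₐ[k] E, g (x * ζ ^ i) with hT
  have hsum : ∑ i ∈ Finset.range (Q.natDegree + 1), Q.coeff i * T i = x * Q.eval ζ := by
    have h1 : ∑ i ∈ Finset.range (Q.natDegree + 1), Q.coeff i * T i
        = ∑ g : E ≃ₐ[k] E, g x * Q.eval (g ζ) := by
      simp only [hT, Finset.mul_sum]
      rw [Finset.sum_comm]
      apply Finset.sum_congr rfl
      intro g _
      rw [Polynomial.eval_eq_sum_range, Finset.mul_sum]
      apply Finset.sum_congr rfl
      intro i _
      rw [map_mul, map_pow]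
      ring
    rw [h1, Finset.sum_eq_single (1 : E ≃ₐ[k] E)]
    · simp
    · intro g _ hg
      rw [hQg g hg, mul_zero]
    · simp
  obtain ⟨i, _, hi⟩ := hna.finset_image_add_of_nonempty (fun i => Q.coeff i * T i)
    (t := Finset.range (Q.natDegree + 1)) ⟨0, by simp⟩
  have hi' : abv x ≤ abv (T i) := by
    rw [hsum, map_mul, map_mul, hQζ, mul_one] at hi
    exact hi.trans (mul_le_of_le_one_left (abv.nonneg _) (hQc i))
  have hi2 : abv (T i) ≤ abv x := by
    obtain ⟨g, _, hg⟩ := hna.finset_image_add_of_nonempty (fun g : E ≃ₐ[k] E => g (x * ζ ^ i))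
      (t := Finset.univ) ⟨1, by simp⟩
    refine hg.trans ?_
    rw [hinv, map_mul, map_pow, aζ]
    simp
  refine ⟨Algebra.trace k E (x * ζ ^ i), ?_⟩
  rw [trace_eq_sum_automorphisms]
  exact le_antisymm hi' hi2

theorem abv_nonarch (abv : AbsoluteValue (Qpbar p) ℝ)
    (habv : ∀ x : ℚ_[p], abv (algebraMap ℚ_[p] (Qpbar p) x) = ‖x‖) : IsNonarchimedean abv := by
  intro x y
  rw [spectralNorm_unique_field_norm_ext habv, spectralNorm_unique_field_norm_ext habv,
    spectralNorm_unique_field_norm_ext habv]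
  exact isNonarchimedean_spectralNorm x y

theorem abv_invariant (abv : AbsoluteValue (Qpbar p) ℝ)
    (habv : ∀ x : ℚ_[p], abv (algebraMap ℚ_[p] (Qpbar p) x) = ‖x‖)
    (τ : Qpbar p →ₐ[ℚ_[p]] Qpbar p) (x : Qpbar p) : abv (τ x) = abv x := by
  rw [spectralNorm_unique_field_norm_ext habv, spectralNorm_unique_field_norm_ext habv]
  exact (spectralNorm_eq_of_equiv (AlgEquiv.ofBijective τ
    (Algebra.IsAlgebraic.algHom_bijective τ)) x).symm

theorem abv_p (abv : AbsoluteValue (Qpbar p) ℝ)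
    (habv : ∀ x : ℚ_[p], abv (algebraMap ℚ_[p] (Qpbar p) x) = ‖x‖) :
    abv (p : Qpbar p) = (p : ℝ)⁻¹ := by
  have := habv (p : ℚ_[p])
  rwa [map_natCast, Padic.norm_p] at this

theorem abv_N (abv : AbsoluteValue (Qpbar p) ℝ)
    (habv : ∀ x : ℚ_[p], abv (algebraMap ℚ_[p] (Qpbar p) x) = ‖x‖) (d : ℕ) (hd : 0 < d) :
    abv ((p ^ d - 1 : ℕ) : Qpbar p) = 1 := by
  have := habv ((p ^ d - 1 : ℕ) : ℚ_[p])
  rw [map_natCast] at this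
  rw [this]
  have hp := (Fact.out : p.Prime)
  have h2 : 1 ≤ p ^ d := Nat.one_le_pow _ _ hp.pos
  rw [Padic.norm_natCast_eq_one_iff]
  rw [hp.coprime_iff_not_dvd]
  intro h
  have h3 : p ∣ p ^ d := dvd_pow_self p hd.ne'
  have h4 := (Nat.dvd_sub h3 h)
  rw [Nat.sub_sub_self h2] at h4
  exact hp.one_lt.ne' (Nat.dvd_one.1 h4)

theorem Kur_value (abv : AbsoluteValue (Qpbar p) ℝ)
    (habv : ∀ x : ℚ_[p], abv (algebraMap ℚ_[p] (Qpbar p) x) = ‖x‖) (d : ℕ) (hd : 0 < d)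
    (x : Qpbar p) (hx : x ∈ Kur p d) : ∃ t : ℚ_[p], abv x = ‖t‖ := by
  have hp := (Fact.out : p.Prime)
  have hN : 0 < p ^ d - 1 := by
    have : 1 < p ^ d := Nat.one_lt_pow hd.ne' hp.one_lt
    omega
  have : NeZero (p ^ d - 1) := ⟨hN.ne'⟩
  obtain ⟨ζ, hζ⟩ := HasEnoughRootsOfUnity.exists_primitiveRoot (Qpbar p) (p ^ d - 1)
  have hζK : ζ ∈ Kur p d := IntermediateField.subset_adjoin _ _ hζ.pow_eq_one
  have hK : Kur p d = ℚ_[p]⟮ζ⟯ := by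
    apply le_antisymm
    · refine IntermediateField.adjoin_le_iff.2 ?_
      intro y hy
      obtain ⟨i, _, rfl⟩ := hζ.eq_pow_of_pow_eq_one hy
      exact pow_mem (IntermediateField.mem_adjoin_simple_self _ _) i
    · rwa [IntermediateField.adjoin_simple_le_iff]
  have hfd : FiniteDimensional ℚ_[p] (Kur p d) := by
    rw [hK]
    exact IntermediateField.adjoin.finiteDimensional (Algebra.IsIntegral.isIntegral ζ)
  have hnorm : Normal ℚ_[p] (Kur p d) := by
    rw [IntermediateField.normal_iff_forall_map_le]
    intro τ
    rw [Kur, IntermediateField.adjoin_map]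
    apply IntermediateField.adjoin.mono
    rintro _ ⟨y, hy, rfl⟩
    change (τ y) ^ (p ^ d - 1) = 1
    rw [← map_pow]
    rw [show y ^ (p ^ d - 1) = 1 from hy, map_one]
  have hgal : IsGalois ℚ_[p] (Kur p d) := IsGalois.mk
  let abv' : AbsoluteValue (Kur p d) ℝ := abv.comp (algebraMap (Kur p d) (Qpbar p)).injective
  have habv' : ∀ x : ℚ_[p], abv' (algebraMap ℚ_[p] (Kur p d) x) = ‖x‖ := fun x => habv x
  obtain ⟨t, ht⟩ := unramified_value (k := ℚ_[p]) (E := Kur p d) abv'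
    (fun x y => abv_nonarch p abv habv x y) (by
      intro g x
      rw [spectralNorm_unique_field_norm_ext habv', spectralNorm_unique_field_norm_ext habv']
      exact (spectralNorm_eq_of_equiv g x).symm) (p ^ d - 1)
      (abv_N p abv habv d hd) ⟨ζ, hζK⟩ (by ext; exact hζ.pow_eq_one) (by
      intro g hg
      have : (g : Kur p d →ₐ[ℚ_[p]] Kur p d) = AlgHom.id _ _ := by
        refine IntermediateField.algHom_ext_of_eq_adjoin (s := {ζ}) _ hK ?_
        intro y hy
        obtain rfl : y = ζ := hy
        exact hg
      ext y
      exact congrArg Subtype.val (DFunLike.congr_fun this y)) ⟨x, hx⟩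
  exact ⟨t, ht.trans (habv' t)⟩

theorem psi_isRoot (w x : Qpbar p) :
    (psiPoly p w).IsRoot x ↔ ((x + w * p) - w * p) * (x + w * p) ^ (p - 1) = -p := by
  simp only [psiPoly, IsRoot, eval_add, eval_mul, eval_pow, eval_X, eval_C, add_sub_cancel_right]
  exact eq_neg_iff_add_eq_zero.symm

theorem psi_monic_aux {R : Type*} [CommRing R] [Nontrivial R] (c e : R) :
    (X * (X + C c) ^ (p - 1) + C e : R[X]).Monic ∧
      (X * (X + C c) ^ (p - 1) + C e : R[X]).natDegree = p := by
  have hp := (Fact.out : p.Prime)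
  have h1 : (X * (X + C c) ^ (p - 1) : R[X]).Monic := monic_X.mul ((monic_X_add_C c).pow _)
  have h2 : (X * (X + C c) ^ (p - 1) : R[X]).natDegree = p := by
    rw [monic_X.natDegree_mul ((monic_X_add_C c).pow _), (monic_X_add_C c).natDegree_pow]
    simp only [natDegree_X, natDegree_X_add_C, mul_one]
    have := hp.two_le
    omega
  have h3 : (C e : R[X]).degree < (X * (X + C c) ^ (p - 1) : R[X]).degree := by
    refine degree_C_le.trans_lt ?_
    rw [← natDegree_pos_iff_degree_pos, h2]
    exact hp.pos
  refine ⟨h1.add_of_left h3, ?_⟩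
  rw [natDegree_add_eq_left_of_degree_lt h3, h2]

theorem multiset_prod_le_pow (s : Multiset ℝ) (c : ℝ) (h0 : ∀ x ∈ s, 0 ≤ x) (h : ∀ x ∈ s, x ≤ c)
    (hc : 0 ≤ c) : s.prod ≤ c ^ s.card := by
  induction s using Multiset.induction_on with
  | empty => simp
  | cons a s ih =>
    rw [Multiset.prod_cons, Multiset.card_cons, pow_succ']
    have := ih (fun x hx => h0 x (Multiset.mem_cons_of_mem hx))
      (fun x hx => h x (Multiset.mem_cons_of_mem hx))
    have h3 : 0 ≤ s.prod := Multiset.prod_nonneg (fun x hx => h0 x (Multiset.mem_cons_of_mem hx))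
    exact mul_le_mul (h a (Multiset.mem_cons_self a s)) this h3 hc

theorem multiset_prod_eq_pow (s : Multiset ℝ) (c : ℝ) (h : ∀ x ∈ s, x = c) :
    s.prod = c ^ s.card := by
  rw [Multiset.eq_replicate_card.2 h, Multiset.prod_replicate, Multiset.card_replicate]

/-- Value of `ψ_u` at a root of `ψ_{u'}`. -/
theorem psi_eval_other (hodd : Odd p) {F : Type*} [Field F] (abv : AbsoluteValue F ℝ)
    (hna : IsNonarchimedean abv)
    (hp1 : abv (p : F) < 1) (hp0 : (p : F) ≠ 0) (u u' x : F) (hu : abv u = 1) (hu' : abv u' = 1)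
    (huu : abv (u - u') = 1) (hx : ((x + u' * p) - u' * p) * (x + u' * p) ^ (p - 1) = -p) :
    abv x ^ p = abv (p : F) ∧
      abv (x * (x + u * p) ^ (p - 1) + p) = abv x ^ (2 * p - 1) := by
  have hp := (Fact.out : p.Prime)
  have hp3 : 3 ≤ p := by
    obtain ⟨m, hm⟩ := hodd
    have := hp.two_le
    omega
  obtain ⟨h1, h2, h3⟩ := psi_root_abs p abv hna hp1 hp0 u' _ hu'.le hx
  rw [add_sub_cancel_right] at h3
  rw [← h3] at h1 h2
  refine ⟨h2, ?_⟩
  rw [map_mul, hu', one_mul] at h1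
  have hxpos : 0 < abv x := (abv.nonneg _).trans_lt h1
  have hx0 : x ≠ 0 := by
    rintro rfl
    simp at hxpos
  have hd : ∀ w : F, abv w = 1 → abv (w * p / x) < 1 := by
    intro w hw
    rw [map_div₀, map_mul, hw, one_mul]
    exact (div_lt_one hxpos).2 h1
  have := avRing_charP p abv hna hp1
  set A : avRing abv hna := 1 + ⟨u * p / x, (hd u hu).le⟩ with hA
  set B : avRing abv hna := 1 + ⟨u' * p / x, (hd u' hu').le⟩ with hB
  have rA : IsLocalRing.residue _ A = 1 := by
    rw [hA, map_add, map_one, (avRing_residue_eq_zero _ _ _).2 (hd u hu), add_zero]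
  have rB : IsLocalRing.residue _ B = 1 := by
    rw [hB, map_add, map_one, (avRing_residue_eq_zero _ _ _).2 (hd u' hu'), add_zero]
  have eA : x + u * p = x * A := by
    change x + u * p = x * (1 + u * p / x)
    field_simp
  have eB : x + u' * p = x * B := by
    change x + u' * p = x * (1 + u' * p / x)
    field_simp
  set S : avRing abv hna := ∑ i ∈ Finset.range (p - 1), A ^ i * B ^ (p - 1 - 1 - i) with hS
  have hSg : S * (A - B) = A ^ (p - 1) - B ^ (p - 1) := (Commute.all A B).geom_sum₂_mul (p - 1)
  have hSgF : (S : F) * (A - B) = (A : F) ^ (p - 1) - (B : F) ^ (p - 1) := by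
    have := congrArg Subtype.val hSg
    simpa using this
  have hSabs : abv (S : F) = 1 := by
    have h4 : ¬ abv (S : F) < 1 := by
      rw [← avRing_residue_eq_zero abv hna, hS, map_sum]
      simp only [map_mul, map_pow, rA, rB, one_pow, mul_one, Finset.sum_const, Finset.card_range,
        nsmul_eq_mul]
      rw [Nat.cast_sub (by omega), CharP.cast_eq_zero]
      simp
    exact le_antisymm S.2 (not_lt.1 h4)
  have hval : x * (x + u * p) ^ (p - 1) + p = x ^ (p - 1) * S * ((u - u') * p) := by
    have h5 : (p : F) = - (x * (x + u' * p) ^ (p - 1)) := by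
      rw [add_sub_cancel_right] at hx
      rw [hx, neg_neg]
    have h6 : (u - u') * p = x * (A - B) := by linear_combination eA - eB
    rw [h6]
    nth_rewrite 2 [h5]
    rw [eA, eB, mul_pow, mul_pow]
    linear_combination -(x * x ^ (p - 1)) * hSgF
  rw [hval, map_mul, map_mul, map_mul, hSabs, huu, ← h2, map_pow, mul_one, one_mul, ← pow_add]
  congr 1
  omega

theorem conj_const_coeff (abv : AbsoluteValue (Qpbar p) ℝ)
    (habv : ∀ x : ℚ_[p], abv (algebraMap ℚ_[p] (Qpbar p) x) = ‖x‖)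
    (K : IntermediateField ℚ_[p] (Qpbar p)) (x : Qpbar p) :
    abv (((minpoly K x).coeff 0 : K) : Qpbar p) = abv x ^ (minpoly K x).natDegree := by
  have hint : IsIntegral K x := Algebra.IsIntegral.isIntegral x
  set f : (Qpbar p)[X] := (minpoly K x).map (algebraMap K (Qpbar p)) with hf
  have hfm : f.Monic := (minpoly.monic hint).map _
  have hsp : f.Splits := IsAlgClosed.splits f
  have h1 := hsp.coeff_zero_eq_prod_roots_of_monic hfm
  rw [hf, coeff_map, ← hf] at h1
  have h2 : (((minpoly K x).coeff 0 : K) : Qpbar p) = (-1) ^ f.natDegree * f.roots.prod := h1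
  rw [h2, map_mul, map_pow, abv.map_neg, map_one, one_pow, one_mul, map_multiset_prod]
  have h3 : Multiset.card (f.roots.map abv) = (minpoly K x).natDegree := by
    rw [Multiset.card_map, ← hsp.natDegree_eq_card_roots, hf, natDegree_map]
  rw [← h3]
  apply multiset_prod_eq_pow
  intro z hz
  obtain ⟨y, hy, rfl⟩ := Multiset.mem_map.1 hz
  have hy' : aeval y (minpoly K x) = 0 := by
    have := isRoot_of_mem_roots hy
    rw [hf, IsRoot, eval_map_algebraMap] at this
    exact this
  obtain ⟨g, hg⟩ := minpoly.exists_algEquiv_of_root' hint.isAlgebraic hy'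
  rw [← hg]
  exact abv_invariant p abv habv ((g : Qpbar p →ₐ[K] Qpbar p).restrictScalars ℚ_[p]) x

theorem Msplit_injective (hodd : Odd p) (d : ℕ) (hd : 0 < d)
    (abv : AbsoluteValue (Qpbar p) ℝ)
    (habv : ∀ x : ℚ_[p], abv (algebraMap ℚ_[p] (Qpbar p) x) = ‖x‖)
    (v u u' : Qpbar p) (hv : v ^ (p ^ d - 1) = 1) (huv : v ^ (p - 1) * u = 1)
    (hu' : u' ^ (p ^ d - 1) = 1) (hM : Msplit p d u = Msplit p d u') : u = u' := by
  have hp := (Fact.out : p.Prime)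
  have hna := abv_nonarch p abv habv
  have hpabs := abv_p p abv habv
  have hp1 : abv (p : Qpbar p) < 1 := by
    rw [hpabs]
    exact inv_lt_one_of_one_lt₀ (by exact_mod_cast hp.one_lt)
  have hp0 : (p : Qpbar p) ≠ 0 := by exact_mod_cast hp.ne_zero
  have hN : p ^ d - 1 ≠ 0 := by
    have : 1 < p ^ d := Nat.one_lt_pow hd.ne' hp.one_lt
    omega
  have hrou : ∀ z : Qpbar p, z ^ (p ^ d - 1) = 1 → abv z = 1 := by
    intro z hz
    have : abv z ^ (p ^ d - 1) = 1 := by rw [← map_pow, hz, map_one]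
    exact (pow_eq_one_iff_of_nonneg (abv.nonneg _) hN).1 this
  have hu : u ^ (p ^ d - 1) = 1 := by
    have := congrArg (· ^ (p ^ d - 1)) huv
    simp only [mul_pow, one_pow] at this
    rw [← pow_mul, mul_comm (p - 1), pow_mul, hv, one_pow, one_mul] at this
    exact this
  have av := hrou v hv
  have au := hrou u hu
  have au' := hrou u' hu'
  by_contra hne
  have huu : abv (u - u') = 1 := by
    apply le_antisymm
    · rw [sub_eq_add_neg]
      refine (hna _ _).trans (max_le au.le ?_)
      rw [abv.map_neg, au']
    · by_contra hcon
      exact hne (root_of_unity_eq abv hna _ (abv_N p abv habv d hd) u u' hu hu' (not_le.1 hcon))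
  -- a root of `ψ_{u'}`
  have hdeg : ∀ w, (psiPoly p w).Monic ∧ (psiPoly p w).natDegree = p := fun w =>
    psi_monic_aux p _ _
  obtain ⟨x, hx⟩ := IsAlgClosed.exists_root (psiPoly p u') (by
    apply ne_of_gt
    rw [← natDegree_pos_iff_degree_pos, (hdeg u').2]
    exact hp.pos)
  have hxM : x ∈ Msplit p d u := by
    rw [hM]
    exact (le_sup_right : _ ≤ Msplit p d u') (IntermediateField.subset_adjoin _ _ hx)
  obtain ⟨hx1, hx2⟩ := psi_eval_other p hodd abv hna hp1 hp0 u u' x au au' huu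
    ((psi_isRoot p u' x).1 hx)
  have hxpos : 0 < abv x := by
    by_contra hcon
    have : abv x = 0 := le_antisymm (not_lt.1 hcon) (abv.nonneg _)
    rw [this, zero_pow hp.ne_zero, hpabs] at hx1
    have : (0 : ℝ) < (p : ℝ)⁻¹ := inv_pos.2 (by exact_mod_cast hp.pos)
    linarith
  have hxlt : abv x < 1 := by
    by_contra hcon
    have := one_le_pow₀ (not_lt.1 hcon) (n := p)
    linarith
  have hsp : (psiPoly p u).Splits := IsAlgClosed.splits _
  have hcard : Multiset.card (psiPoly p u).roots = p := by
    rw [← hsp.natDegree_eq_card_roots, (hdeg u).2]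
  have hprod : (((psiPoly p u).roots.map fun ρ => abv (x - ρ)).prod) = abv x ^ (2 * p - 1) := by
    rw [← hx2]
    have h1 := hsp.eval_eq_prod_roots_of_monic (hdeg u).1 x
    have h2 : (psiPoly p u).eval x = x * (x + u * p) ^ (p - 1) + p := by
      simp [psiPoly]
    rw [← h2, h1, map_multiset_prod, Multiset.map_map]
    rfl
  have hrootabs : ∀ ρ ∈ (psiPoly p u).roots, abv (ρ + u * p) = abv x := by
    intro ρ hρ
    have h1 := (psi_isRoot p u ρ).1 (isRoot_of_mem_roots hρ)
    obtain ⟨_, h2, _⟩ := psi_root_abs p abv hna hp1 hp0 u _ au.le h1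
    exact (pow_left_inj₀ (abv.nonneg _) (abv.nonneg _) hp.ne_zero).1 (h2.trans hx1.symm)
  have hdist : ∀ ρ ∈ (psiPoly p u).roots, ∀ ρ' ∈ (psiPoly p u).roots,
      abv (ρ' - ρ) ≤ abv x ^ 2 := by
    intro ρ hρ ρ' hρ'
    by_cases h : ρ' = ρ
    · rw [h, sub_self, map_zero]; positivity
    · have h1 := (psi_isRoot p u ρ).1 (isRoot_of_mem_roots hρ)
      have h2 := (psi_isRoot p u ρ').1 (isRoot_of_mem_roots hρ')
      have h3 := psi_root_dist p abv hna hp1 hp0 u _ _ au h1 h2 (by simpa using h)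
      rw [hrootabs ρ hρ] at h3
      rw [← h3]
      apply le_of_eq
      congr 1
      ring
  obtain ⟨ρ, hρ, hρx⟩ : ∃ ρ ∈ (psiPoly p u).roots, abv x ^ 2 < abv (x - ρ) := by
    by_contra hcon
    push Not at hcon
    have h1 := multiset_prod_le_pow ((psiPoly p u).roots.map fun ρ => abv (x - ρ)) (abv x ^ 2)
      (by
        intro z hz
        obtain ⟨y, _, rfl⟩ := Multiset.mem_map.1 hz
        exact abv.nonneg _)
      (by
        intro z hz
        obtain ⟨y, hy, rfl⟩ := Multiset.mem_map.1 hz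
        exact hcon y hy) (by positivity)
    rw [hprod, Multiset.card_map, hcard, ← pow_mul] at h1
    have h2 : abv x ^ (2 * p) < abv x ^ (2 * p - 1) :=
      pow_lt_pow_right_of_lt_one₀ hxpos hxlt (by have := hp.pos; omega)
    linarith
  have hall : ∀ ρ' ∈ (psiPoly p u).roots, abv (x - ρ') = abv (x - ρ) := by
    intro ρ' hρ'
    have h1 : x - ρ' = (x - ρ) + (ρ - ρ') := by ring
    rw [h1]
    exact hna.add_eq_left_of_lt ((hdist ρ' hρ' ρ hρ).trans_lt hρx)
  have hs : abv (x - ρ) ^ p = abv x ^ (2 * p - 1) := by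
    rw [← hprod]
    have := multiset_prod_eq_pow (s := (psiPoly p u).roots.map fun ρ => abv (x - ρ))
      (c := abv (x - ρ)) (by
        intro z hz
        obtain ⟨y, hy, rfl⟩ := Multiset.mem_map.1 hz
        exact hall y hy)
    rw [this, Multiset.card_map, hcard]
  have hs2 : abv (x - ρ) ^ (p * p) = ((p : ℝ)⁻¹) ^ (2 * p - 1) := by
    rw [pow_mul, hs, ← pow_mul, mul_comm, pow_mul, hx1, hpabs]
  -- field theory
  set K := Kur p d with hK
  have hvK : v ∈ K := IntermediateField.subset_adjoin _ _ hv
  have huK : u ∈ K := IntermediateField.subset_adjoin _ _ hu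
  have hρroot := isRoot_of_mem_roots hρ
  have hMle : Msplit p d u ≤ (IntermediateField.adjoin K {ρ}).restrictScalars ℚ_[p] := by
    rw [Msplit]
    apply sup_le
    · intro y hy
      exact (IntermediateField.adjoin K {ρ}).algebraMap_mem ⟨y, hy⟩
    · rw [IntermediateField.adjoin_le_iff]
      intro y hy
      change y ∈ IntermediateField.adjoin K {ρ}
      rw [← InfiniteGalois.fixedField_fixingSubgroup (IntermediateField.adjoin K {ρ}),
        IntermediateField.mem_fixedField_iff]
      intro τ hτ
      have hτρ : τ ρ = ρ := by
        rw [IntermediateField.mem_fixingSubgroup_iff] at hτ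
        exact hτ ρ (IntermediateField.mem_adjoin_simple_self K ρ)
      have hτK : ∀ z ∈ K, τ z = z := fun z hz => τ.commutes ⟨z, hz⟩
      have h1 := (psi_isRoot p u ρ).1 hρroot
      have h2 := (psi_isRoot p u y).1 hy
      have h3 := psi_root_fixed p abv hna hp1 hp0 u v _ _ av huv h1 h2
        (τ : Qpbar p →+* Qpbar p)
        (fun z => abv_invariant p abv habv ((τ : Qpbar p →ₐ[K] Qpbar p).restrictScalars ℚ_[p]) z)
        (hτK v hvK) (by
          change τ (ρ + u * p) = _
          rw [map_add, map_mul, hτρ, hτK u huK, map_natCast])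
      change τ (y + u * p) = _ at h3
      rw [map_add, map_mul, hτK u huK, map_natCast] at h3
      exact add_right_cancel h3
  have hxK : x ∈ IntermediateField.adjoin K {ρ} := hMle hxM
  have hρK : ρ ∈ IntermediateField.adjoin K {ρ} := IntermediateField.mem_adjoin_simple_self K ρ
  have hint : IsIntegral K ρ := Algebra.IsIntegral.isIntegral ρ
  have hfd : FiniteDimensional K (IntermediateField.adjoin K {ρ}) :=
    IntermediateField.adjoin.finiteDimensional hint
  have hdegρ : (minpoly K ρ).natDegree ≤ p := by
    obtain ⟨h1, h2⟩ := psi_monic_aux p (R := K) (⟨u, huK⟩ * (p : K)) (p : K)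
    refine le_trans (natDegree_le_natDegree ?_) h2.le
    apply minpoly.min K ρ h1
    have h3 : (psiPoly p u).eval ρ = 0 := hρroot
    simp only [psiPoly, eval_add, eval_mul, eval_pow, eval_X, eval_C] at h3
    simp only [map_add, map_mul, map_pow, aeval_X, aeval_C, map_natCast]
    exact h3
  have hn : (minpoly K (x - ρ)).natDegree ≤ p := by
    refine le_trans ?_ hdegρ
    rw [← IntermediateField.adjoin.finrank hint]
    have := minpoly.natDegree_le (A := K)
      (⟨x - ρ, sub_mem hxK hρK⟩ : IntermediateField.adjoin K {ρ})
    rwa [IntermediateField.minpoly_eq] at this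
  have hn0 : 0 < (minpoly K (x - ρ)).natDegree :=
    minpoly.natDegree_pos (Algebra.IsIntegral.isIntegral _)
  have hc := conj_const_coeff p abv habv K (x - ρ)
  set n := (minpoly K (x - ρ)).natDegree with hndef
  obtain ⟨t, ht⟩ := Kur_value p abv habv d hd _ ((minpoly K (x - ρ)).coeff 0).2
  rw [hc] at ht
  have hspos : 0 < abv (x - ρ) := lt_trans (by positivity) hρx
  have ht0 : t ≠ 0 := by
    rintro rfl
    rw [norm_zero] at ht
    exact (pow_pos hspos n).ne' ht
  rw [Padic.norm_eq_zpow_neg_valuation ht0] at ht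
  have hfin : (p : ℝ) ^ (-t.valuation * ((p * p : ℕ) : ℤ)) =
      (p : ℝ) ^ (-(((2 * p - 1) * n : ℕ) : ℤ)) := by
    rw [zpow_mul, ← ht, zpow_natCast, ← pow_mul, mul_comm n, pow_mul, hs2, ← pow_mul, zpow_neg,
      zpow_natCast, inv_pow]
  have hpR : (1 : ℝ) < p := by exact_mod_cast hp.one_lt
  have hZ := zpow_right_injective₀ (by linarith) hpR.ne' hfin
  have hdvdZ : ((p * p : ℕ) : ℤ) ∣ (((2 * p - 1) * n : ℕ) : ℤ) :=
    ⟨t.valuation, by linear_combination hZ⟩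
  have hdvd : p * p ∣ (2 * p - 1) * n := by exact_mod_cast hdvdZ
  have hcop : Nat.Coprime (p * p) (2 * p - 1) := by
    have : Nat.Coprime p (2 * p - 1) := by
      rw [hp.coprime_iff_not_dvd]
      intro h
      have h2 := Nat.dvd_sub (Dvd.intro_left 2 rfl : p ∣ 2 * p) h
      have h3 := hp.two_le
      rw [Nat.sub_sub_self (by omega)] at h2
      exact hp.one_lt.ne' (Nat.dvd_one.1 h2)
    exact Nat.Coprime.mul_left this this
  have h1 := Nat.le_of_dvd hn0 (hcop.dvd_of_dvd_mul_left hdvd)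
  have h2 := hp.two_le
  nlinarith

theorem image_setOf (τ : Qpbar p →ₐ[ℚ_[p]] Qpbar p) (P P' : Qpbar p → Prop)
    (h : ∀ x, P' (τ x) ↔ P x) : τ '' {x | P x} = {x | P' x} := by
  ext y
  constructor
  · rintro ⟨x, hx, rfl⟩
    exact (h x).2 hx
  · intro hy
    obtain ⟨x, rfl⟩ := (Algebra.IsAlgebraic.algHom_bijective τ).2 y
    exact ⟨x, (h x).1 hy, rfl⟩

theorem Kur_map (d : ℕ) (τ : Qpbar p →ₐ[ℚ_[p]] Qpbar p) : (Kur p d).map τ = Kur p d := by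
  rw [Kur, IntermediateField.adjoin_map, image_setOf p τ _ (fun x => x ^ (p ^ d - 1) = 1)]
  intro x
  rw [← map_pow]
  exact map_eq_one_iff τ τ.injective

theorem Lsplit_map (d : ℕ) (τ : Qpbar p →ₐ[ℚ_[p]] Qpbar p) (w : Qpbar p) :
    (Lsplit p d w).map τ = Lsplit p d (τ w) := by
  rw [Lsplit, Lsplit, IntermediateField.map_sup, Kur_map, IntermediateField.adjoin_map,
    image_setOf p τ _ (fun x => (((X ^ p + C (τ w * (p : Qpbar p)) * X) ^ (p - 1)
      + C (p : Qpbar p)) : Polynomial (Qpbar p)).IsRoot x)]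
  intro x
  rw [IsRoot, IsRoot]
  conv_rhs => rw [← map_eq_zero_iff τ τ.injective]
  simp

theorem Msplit_map (d : ℕ) (τ : Qpbar p →ₐ[ℚ_[p]] Qpbar p) (w : Qpbar p) :
    (Msplit p d w).map τ = Msplit p d (τ w) := by
  rw [Msplit, Msplit, IntermediateField.map_sup, Kur_map, IntermediateField.adjoin_map,
    image_setOf p τ _ (fun x => (psiPoly p (τ w)).IsRoot x)]
  intro x
  rw [IsRoot, IsRoot]
  conv_rhs => rw [← map_eq_zero_iff τ τ.injective]
  simp [psiPoly]

/-- let `σ` be the Frobenius generator of `Gal(K/ℚ_p)` (characterized by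
`σ(x) ≡ x^p mod P_K` on `O_K`), let `v ∈ μ_{q-1}`, `u = v^{1-p}`, and let `σ̃` be any
embedding of `ℚ̄_p` into itself over `ℚ_p` restricting to `σ` on `K`.  Then
`σ̃(L_u)` is the splitting field over `K` of `(X^p + σ(u) p X)^{p-1} + p`, and
`σ̃(M_u) = M_{σ(u)}`.  Moreover `M_u/ℚ_p` is Galois iff `σ(u) = u`, i.e. iff `u^p = u`. -/
theorem statement10 (hp : Odd p) (d : ℕ) (hd : 0 < d)
    (abv : AbsoluteValue (Qpbar p) ℝ)
    (habv : ∀ x : ℚ_[p], abv (algebraMap ℚ_[p] (Qpbar p) x) = ‖x‖)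
    (σ : Kur p d ≃ₐ[ℚ_[p]] Kur p d)
    (hσ : ∀ x : Kur p d, abv ↑x ≤ 1 → abv (↑(σ x) - (↑x : Qpbar p) ^ p) < 1)
    (v : Qpbar p) (hv : v ^ (p ^ d - 1) = 1)
    (u : Qpbar p) (hu : u = v ^ ((1 : ℤ) - (p : ℤ))) (huK : u ∈ Kur p d)
    (σt : Qpbar p →ₐ[ℚ_[p]] Qpbar p)
    (hres : ∀ x : Kur p d, σt ↑x = ↑(σ x)) :
    (Lsplit p d u).map σt = Lsplit p d ↑(σ ⟨u, huK⟩) ∧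
    (Msplit p d u).map σt = Msplit p d ↑(σ ⟨u, huK⟩) ∧
    (IsGalois ℚ_[p] (Msplit p d u) ↔ (↑(σ ⟨u, huK⟩) : Qpbar p) = u) ∧
    ((↑(σ ⟨u, huK⟩) : Qpbar p) = u ↔ u ^ p = u) := by
  have hpr := (Fact.out : p.Prime)
  have hna := abv_nonarch p abv habv
  have hpabs := abv_p p abv habv
  have hp1 : abv (p : Qpbar p) < 1 := by
    rw [hpabs]
    exact inv_lt_one_of_one_lt₀ (by exact_mod_cast hpr.one_lt)
  have hN : p ^ d - 1 ≠ 0 := by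
    have : 1 < p ^ d := Nat.one_lt_pow hd.ne' hpr.one_lt
    omega
  have hNabs := abv_N p abv habv d hd
  have hv0 : v ≠ 0 := by
    rintro rfl
    rw [zero_pow hN] at hv
    exact zero_ne_one hv
  have huv : v ^ (p - 1) * u = 1 := by
    have h1 : v ^ (p - 1) = v ^ ((p : ℤ) - 1) := by
      rw [← zpow_natCast, Nat.cast_sub hpr.one_le]
      simp
    rw [hu, h1, ← zpow_add₀ hv0]
    simp
  have huN : u ^ (p ^ d - 1) = 1 := by
    have := congrArg (· ^ (p ^ d - 1)) huv
    simp only [mul_pow, one_pow] at this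
    rw [← pow_mul, mul_comm (p - 1), pow_mul, hv, one_pow, one_mul] at this
    exact this
  have hu0 : u ≠ 0 := by
    rintro rfl
    simp at huv
  have au : abv u = 1 := by
    have : abv u ^ (p ^ d - 1) = 1 := by rw [← map_pow, huN, map_one]
    exact (pow_eq_one_iff_of_nonneg (abv.nonneg _) hN).1 this
  have hσt : (↑(σ ⟨u, huK⟩) : Qpbar p) = σt u := (hres ⟨u, huK⟩).symm
  have hσN : (σt u) ^ (p ^ d - 1) = 1 := by rw [← map_pow, huN, map_one]
  have hσp : σt u = u ^ p := by
    have h1 := hσ ⟨u, huK⟩ au.le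
    rw [hσt] at h1
    exact root_of_unity_eq abv hna _ hNabs _ _ hσN
      (by rw [← pow_mul, mul_comm, pow_mul, huN, one_pow]) h1
  rw [hσt]
  refine ⟨Lsplit_map p d σt u, Msplit_map p d σt u, ⟨?_, ?_⟩, by rw [hσp]⟩
  · intro hG
    have h1 : Normal ℚ_[p] (Msplit p d u) := hG.to_normal
    have h2 := IntermediateField.normal_iff_forall_map_eq.1 h1 σt
    rw [Msplit_map] at h2
    exact (Msplit_injective p hp d hd abv habv v u (σt u) hv huv hσN h2.symm).symm
  · intro hfix
    have hup : u ^ p = u := by rw [← hσp, hfix]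
    obtain ⟨n, hn⟩ := exists_int_close p abv hna hp1 u au.le (by
      rw [hup, sub_self, map_zero]; exact one_pos)
    have hnorm : Normal ℚ_[p] (Msplit p d u) := by
      rw [IntermediateField.normal_iff_forall_map_eq]
      intro τ
      rw [Msplit_map]
      congr 1
      refine root_of_unity_eq abv hna _ hNabs _ _ (by rw [← map_pow, huN, map_one]) huN ?_
      have h1 : abv (τ u - n) < 1 := by
        have := abv_invariant p abv habv τ (u - n)
        rw [map_sub, map_natCast] at this
        rw [this]; exact hn
      have h2 : τ u - u = (τ u - n) + (-(u - n)) := by ring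
      rw [h2]
      refine (hna _ _).trans_lt (max_lt h1 ?_)
      rw [abv.map_neg]; exact hn
    exact IsGalois.mk
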